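/- arXiv:2511.04782 — 9 statements merged into one kernel-verified Lean document; each statement's English description precedes it below -/
import Mathlib

section
/- Fix strictly positive reals σ, λ, ψ, μ, β, m_xx, m_xπ, m_ππ, a real p ∈ [0,1], real expectation values x′ and π′, and a real shock d. Then the one-step piecewise-linear system x = m_xx·p·x′ − σ·(max(ψπ, −μ) − m_xπ·p·π′) − d and π = λx + m_ππ·β·p·π′ has exactly one solution (x, π) ∈ ℝ². -/
/-- For `k, ψ ≥ 0` the map `y ↦ y + k * max (ψ * y) m` is a bijection of `ℝ`. -/
theorem existsUnique_add_mul_max_eq {k ψ : ℝ} (hk : 0 ≤ k) (hψ : 0 ≤ ψ) (m c : ℝ) :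
    ∃! y : ℝ, y + k * max (ψ * y) m = c := by
  have hmono : StrictMono fun y : ℝ => y + k * max (ψ * y) m := fun y z hyz =>
    add_lt_add_of_lt_of_le hyz <| mul_le_mul_of_nonneg_left
      (max_le_max_right m (mul_le_mul_of_nonneg_left hyz.le hψ)) hk
  refine existsUnique_of_exists_of_unique ?_ fun y z hy hz =>
    hmono.injective (hy.trans hz.symm)
  rcases le_total (ψ * (c - k * m)) m with h | h
  · exact ⟨c - k * m, by rw [max_eq_right h]; ring⟩
  · have hpos : 0 < 1 + k * ψ := by positivity
    refine ⟨c / (1 + k * ψ), ?_⟩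
    have hm : m ≤ ψ * (c / (1 + k * ψ)) := by
      rw [← mul_div_assoc, le_div_iff₀ hpos]
      linarith
    rw [max_eq_left hm]
    field_simp

/-- One step of the backward induction: given next-period expectation
values `(x', π')`, the piecewise-linear system
`x = m_xx·p·x' − σ·(max(ψπ, −μ) − m_xπ·p·π') − d`,
`π = λx + m_ππ·β·p·π'` has exactly one solution `(x, π)`. -/
theorem one_step_unique_solution
    (σ lam ψ μ β mxx mxpi mpipi : ℝ)
    (hσ : 0 < σ) (hlam : 0 < lam) (hψ : 0 < ψ) (hμ : 0 < μ) (hβ : 0 < β)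
    (hmxx : 0 < mxx) (hmxpi : 0 < mxpi) (hmpipi : 0 < mpipi)
    (p : ℝ) (hp : p ∈ Set.Icc (0 : ℝ) 1) (xnext pinext d : ℝ) :
    ∃! xp : ℝ × ℝ,
      xp.1 = mxx * p * xnext - σ * (max (ψ * xp.2) (-μ) - mxpi * p * pinext) - d ∧
      xp.2 = lam * xp.1 + mpipi * β * p * pinext := by
  obtain ⟨y, hy, huniq⟩ := existsUnique_add_mul_max_eq (mul_pos hlam hσ).le hψ.le (-μ)
    (lam * (mxx * p * xnext + σ * (mxpi * p * pinext) - d) + mpipi * β * p * pinext)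
  refine ⟨(mxx * p * xnext - σ * (max (ψ * y) (-μ) - mxpi * p * pinext) - d, y),
    ⟨rfl, by linear_combination hy⟩, ?_⟩
  rintro ⟨x, z⟩ ⟨hx, hz⟩
  dsimp only at hx hz
  obtain rfl : z = y := huniq z (by linear_combination hz + lam * hx)
  exact Prod.ext hx rfl
end

section
/- Fix strictly positive reals σ, λ, ψ, μ, β, m_xx, m_xπ, m_ππ, a real p ∈ [0,1], a real shock d, and an integer ℓ ≥ 1. Then there exists exactly one finite sequence ((x_k, π_k))_{k=0}^{ℓ−1} in ℝ² that, with the terminal convention x_ℓ = π_ℓ = 0, satisfies for every k ∈ {0,…,ℓ−1}: x_k = m_xx·p·x_{k+1} − σ·(max(ψπ_k, −μ) − m_xπ·p·π_{k+1}) − d and π_k = λ x_k + m_ππ·β·p·π_{k+1}. -/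
/-- A backward recursion `c_k = F c_{k+1}` on `{0, …, ℓ - 1}` with terminal value `z`
has exactly one solution. -/
theorem existsUnique_backward_recursion {α : Type*} (F : α → α) (z : α) (ℓ : ℕ) :
    ∃! X : Fin ℓ → α, ∀ k : Fin ℓ,
      X k = F (if h : (k : ℕ) + 1 < ℓ then X ⟨(k : ℕ) + 1, h⟩ else z) := by
  refine ⟨fun k => F^[ℓ - k] z, fun k => ?_, fun Y hY => ?_⟩
  · have hk : ℓ - (k : ℕ) = ℓ - (k + 1) + 1 := by omega
    simp only [hk, Function.iterate_succ_apply']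
    split_ifs with h
    · rfl
    · simp [show ℓ - ((k : ℕ) + 1) = 0 by omega]
  · have key : ∀ (j : ℕ) (k : Fin ℓ), (k : ℕ) + j + 1 = ℓ → Y k = F^[j + 1] z := by
      intro j
      induction j with
      | zero =>
        intro k hk
        rw [hY k, dif_neg (by omega)]
        rfl
      | succ j ih =>
        intro k hk
        have h : (k : ℕ) + 1 < ℓ := by omega
        rw [hY k, dif_pos h, ih ⟨k + 1, h⟩ (by simp only; omega),
          ← Function.iterate_succ_apply' F]
    funext k
    rw [key (ℓ - (k + 1)) k (by omega)]
    congr 1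
    omega

/-- Given expectations, summarised by `a` and `b`, the static system consisting of the Euler
equation and the Phillips curve, with the Taylor rule truncated at `-μ`, has exactly one
solution. -/
theorem existsUnique_static_equilibrium {σ lam ψ : ℝ} (μ : ℝ)
    (hσ : 0 < σ) (hlam : 0 < lam) (hψ : 0 < ψ) (a b : ℝ) :
    ∃! c : ℝ × ℝ, c.1 = a - σ * max (ψ * c.2) (-μ) ∧ c.2 = lam * c.1 + b := by
  have hD : 0 < 1 + σ * lam * ψ := by positivity
  apply existsUnique_of_exists_of_unique
  · by_cases h : -μ * (1 + σ * lam * ψ) ≤ ψ * (lam * a + b)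
    · have hmax : -μ ≤ ψ * ((lam * a + b) / (1 + σ * lam * ψ)) := by
        rwa [← mul_div_assoc, le_div_iff₀ hD]
      refine ⟨(a - σ * (ψ * ((lam * a + b) / (1 + σ * lam * ψ))),
        (lam * a + b) / (1 + σ * lam * ψ)), ?_, ?_⟩
      · simp only [max_eq_left hmax]
      · field_simp
        ring
    · have hmax : ψ * (lam * (a + σ * μ) + b) ≤ -μ := by
        linarith
      refine ⟨(a + σ * μ, lam * (a + σ * μ) + b), ?_, rfl⟩
      simp only [max_eq_right hmax]
      ring
  · rintro ⟨x, y⟩ ⟨x', y'⟩ ⟨hx, hy⟩ ⟨hx', hy'⟩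
    simp only at hx hy hx' hy'
    have mono : ∀ u v : ℝ, u ≤ v →
        lam * (σ * max (ψ * u) (-μ)) ≤ lam * (σ * max (ψ * v) (-μ)) := by
      intro u v huv
      gcongr
    have hy₁ : y = lam * a - lam * (σ * max (ψ * y) (-μ)) + b := by
      rw [← mul_sub, ← hx, ← hy]
    have hy₂ : y' = lam * a - lam * (σ * max (ψ * y') (-μ)) + b := by
      rw [← mul_sub, ← hx', ← hy']
    have hyy : y = y' := by
      rcases le_total y y' with h | h
      · linarith [mono y y' h]
      · linarith [mono y' y h]
    subst hyy
    rw [hx, hx']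

/-- Under a truncated Markov chain of maximal duration `ℓ ≥ 1` there is
exactly one finite sequence `((x_k, π_k))_{k=0}^{ℓ−1}` satisfying, with the terminal
convention `x_ℓ = π_ℓ = 0`, the Euler equation and Phillips curve with the
Taylor rule truncated at the effective lower bound in every period. -/
theorem unique_equilibrium_path
    (σ lam ψ μ β mxx mxpi mpipi : ℝ)
    (hσ : 0 < σ) (hlam : 0 < lam) (hψ : 0 < ψ) (hμ : 0 < μ) (hβ : 0 < β)
    (hmxx : 0 < mxx) (hmxpi : 0 < mxpi) (hmpipi : 0 < mpipi)
    (p : ℝ) (hp : p ∈ Set.Icc (0 : ℝ) 1) (d : ℝ) (ℓ : ℕ) (hℓ : 1 ≤ ℓ) :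
    ∃! Xs : Fin ℓ → ℝ × ℝ,
      ∀ k : Fin ℓ,
        (Xs k).1 =
            mxx * p * (if h : (k : ℕ) + 1 < ℓ then (Xs ⟨(k : ℕ) + 1, h⟩).1 else 0)
            - σ * (max (ψ * (Xs k).2) (-μ)
                - mxpi * p * (if h : (k : ℕ) + 1 < ℓ then (Xs ⟨(k : ℕ) + 1, h⟩).2 else 0))
            - d ∧
        (Xs k).2 =
            lam * (Xs k).1
            + mpipi * β * p * (if h : (k : ℕ) + 1 < ℓ then (Xs ⟨(k : ℕ) + 1, h⟩).2 else 0) := by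
  have step : ∀ n : ℝ × ℝ, ∃ c₀ : ℝ × ℝ, ∀ c : ℝ × ℝ,
      (c.1 = mxx * p * n.1 - σ * (max (ψ * c.2) (-μ) - mxpi * p * n.2) - d ∧
        c.2 = lam * c.1 + mpipi * β * p * n.2) ↔ c = c₀ := by
    intro n
    obtain ⟨c₀, hc₀, huniq⟩ := existsUnique_static_equilibrium μ hσ hlam hψ
      (mxx * p * n.1 + σ * (mxpi * p * n.2) - d) (mpipi * β * p * n.2)
    refine ⟨c₀, fun c => ⟨fun hc => huniq c ⟨by linarith [hc.1], hc.2⟩, ?_⟩⟩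
    rintro rfl
    exact ⟨by linarith [hc₀.1], hc₀.2⟩
  choose F hF using step
  refine (existsUnique_congr fun X => forall_congr' fun k => ?_).mpr
    (existsUnique_backward_recursion F 0 ℓ)
  rw [← hF]
  split_ifs <;> rfl
end

section
/- Let σ, λ, ψ, μ, β, m_xx, m_xπ, m_ππ be strictly positive reals and suppose Assumption 1 holds: ψ < m_xπ/(β·m_ππ). Then the 2×2 matrix A := (1/(1+λσψ))·[[m_xx, σ(m_xπ − ψβm_ππ)], [λm_xx, λσm_xπ + βm_ππ]] has strictly positive entries and its two eigenvalues are real and strictly positive (its characteristic polynomial has nonnegative discriminant and positive roots). -/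
/-- The Normal-Time transition matrix `A` of the New Keynesian model. -/
noncomputable def NKmatA (σ lam ψ β mxx mxpi mpipi : ℝ) : Matrix (Fin 2) (Fin 2) ℝ :=
  (1 / (1 + lam * σ * ψ)) •
    !![mxx, σ * (mxpi - ψ * β * mpipi); lam * mxx, lam * σ * mxpi + β * mpipi]

/-- A real `2 × 2` matrix with positive entries and positive determinant has two positive real
eigenvalues. -/
theorem Matrix.exists_pos_charpoly_eq_mul_of_pos (M : Matrix (Fin 2) (Fin 2) ℝ)
    (hM : ∀ i j, 0 < M i j) (hdet : 0 < M.det) :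
    ∃ r1 r2 : ℝ, 0 < r1 ∧ 0 < r2 ∧
      M.charpoly = (Polynomial.X - Polynomial.C r1) * (Polynomial.X - Polynomial.C r2) := by
  have htrace : 0 < M.trace := by
    rw [Matrix.trace_fin_two]
    exact add_pos (hM 0 0) (hM 1 1)
  have hdisc : 0 ≤ M.trace ^ 2 - 4 * M.det := by
    rw [Matrix.trace_fin_two, Matrix.det_fin_two]
    nlinarith [sq_nonneg (M 0 0 - M 1 1), mul_pos (hM 0 1) (hM 1 0)]
  set s := √(M.trace ^ 2 - 4 * M.det)
  have hs : s ^ 2 = M.trace ^ 2 - 4 * M.det := Real.sq_sqrt hdisc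
  have hs_nonneg : 0 ≤ s := Real.sqrt_nonneg _
  have hs_lt : s < M.trace := lt_of_pow_lt_pow_left₀ 2 htrace.le (by linarith)
  refine ⟨(M.trace + s) / 2, (M.trace - s) / 2, by linarith, by linarith, ?_⟩
  have hsum : M.trace = (M.trace + s) / 2 + (M.trace - s) / 2 := by ring
  have hprod : M.det = (M.trace + s) / 2 * ((M.trace - s) / 2) := by linarith
  generalize (M.trace + s) / 2 = r1, (M.trace - s) / 2 = r2 at hsum hprod
  rw [Matrix.charpoly_fin_two, hsum, hprod, Polynomial.C_add, Polynomial.C_mul]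
  ring

/-- Under Assumption 1 (`ψ < m_xπ/(β m_ππ)`), the matrix `A` has strictly
positive entries and its two eigenvalues are real and strictly positive (the
characteristic polynomial splits into two linear factors with positive roots). -/
theorem A_positive_entries_real_positive_eigenvalues
    (σ lam ψ μ β mxx mxpi mpipi : ℝ)
    (hσ : 0 < σ) (hlam : 0 < lam) (hψ : 0 < ψ) (hμ : 0 < μ) (hβ : 0 < β)
    (hmxx : 0 < mxx) (hmxpi : 0 < mxpi) (hmpipi : 0 < mpipi)
    (hA1 : ψ < mxpi / (β * mpipi)) :
    (∀ i j, 0 < NKmatA σ lam ψ β mxx mxpi mpipi i j) ∧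
    ∃ r1 r2 : ℝ, 0 < r1 ∧ 0 < r2 ∧
      (NKmatA σ lam ψ β mxx mxpi mpipi).charpoly =
        (Polynomial.X - Polynomial.C r1) * (Polynomial.X - Polynomial.C r2) := by
  have hk : 0 < 1 + lam * σ * ψ := by positivity
  have hgap : 0 < mxpi - ψ * β * mpipi := by
    rw [lt_div_iff₀ (by positivity)] at hA1
    linarith
  have hpos : ∀ i j, 0 < NKmatA σ lam ψ β mxx mxpi mpipi i j := by
    intro i j
    fin_cases i <;> fin_cases j <;> simp [NKmatA] <;> positivity
  have hdet : (NKmatA σ lam ψ β mxx mxpi mpipi).det =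
      mxx * β * mpipi / (1 + lam * σ * ψ) := by
    simp only [NKmatA, Matrix.det_smul, Matrix.det_fin_two_of, Fintype.card_fin]
    field_simp
    ring
  exact ⟨hpos, Matrix.exists_pos_charpoly_eq_mul_of_pos _ hpos (by rw [hdet]; positivity)⟩
end

section
/- Let σ, λ, ψ, μ, β, m_xx, m_xπ, m_ππ be strictly positive reals with ψ < m_xπ/(β·m_ππ), let p ∈ (0,1], d > 0, and set A := (1/(1+λσψ))·[[m_xx, σ(m_xπ − ψβm_ππ)], [λm_xx, λσm_xπ + βm_ππ]] and C := (−1/(1+λσψ))·(1, λ)ᵀ. Define X(ℓ) := (Σ_{i=0}^{ℓ−1} (pA)^i)·C·d for ℓ ≥ 1. Then both components of X(ℓ) are strictly negative and strictly decreasing in ℓ: X(ℓ+1) < X(ℓ) componentwise for every ℓ ≥ 1. -/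
/-- The Normal-Time forcing vector `C` of the New Keynesian model. -/
noncomputable def NKvecC (σ lam ψ : ℝ) : Fin 2 → ℝ :=
  (-(1 / (1 + lam * σ * ψ))) • ![1, lam]

/-- Powers of an entrywise positive matrix send entrywise negative vectors to entrywise negative
vectors. -/
lemma Matrix.pow_mulVec_neg_of_pos {n : Type*} [Fintype n] [DecidableEq n] {M : Matrix n n ℝ}
    (hM : ∀ i j, 0 < M i j) {v : n → ℝ} (hv : ∀ j, v j < 0) (k : ℕ) (j : n) :
    ((M ^ k).mulVec v) j < 0 := by
  induction k generalizing j with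
  | zero => simpa using hv j
  | succ k ih =>
    rw [pow_succ', ← Matrix.mulVec_mulVec]
    exact Finset.sum_neg (fun i _ => mul_neg_of_pos_of_neg (hM j i) (ih i)) ⟨j, Finset.mem_univ j⟩

/-- The Normal-Time transition matrix is entrywise positive. -/
lemma NKmatA_pos {σ lam ψ β mxx mxpi mpipi : ℝ}
    (hσ : 0 < σ) (hlam : 0 < lam) (hψ : 0 < ψ) (hβ : 0 < β)
    (hmxx : 0 < mxx) (hmxpi : 0 < mxpi) (hmpipi : 0 < mpipi)
    (hA1 : ψ < mxpi / (β * mpipi)) (i j : Fin 2) :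
    0 < NKmatA σ lam ψ β mxx mxpi mpipi i j := by
  have hgap : 0 < mxpi - ψ * β * mpipi := by
    rw [lt_div_iff₀ (by positivity)] at hA1
    linarith
  unfold NKmatA
  rw [Matrix.smul_apply, smul_eq_mul]
  refine mul_pos (by positivity) ?_
  fin_cases i <;> fin_cases j <;> simp <;> positivity

/-- The Normal-Time forcing vector is entrywise negative. -/
lemma NKvecC_neg {σ lam ψ : ℝ} (hσ : 0 < σ) (hlam : 0 < lam) (hψ : 0 < ψ) (j : Fin 2) :
    NKvecC σ lam ψ j < 0 := by
  unfold NKvecC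
  rw [Pi.smul_apply, smul_eq_mul]
  refine mul_neg_of_neg_of_pos (neg_neg_of_pos (by positivity)) ?_
  fin_cases j <;> simp [hlam]

/-- Under Assumption 1, for `p ∈ (0,1]` and `d > 0`, both components of
the on-impact Normal-Time solution `X(ℓ) = (Σ_{i<ℓ} (pA)^i)·C·d` are strictly negative
and strictly decreasing in the maximal duration `ℓ`. -/
theorem normal_time_path_negative_decreasing
    (σ lam ψ μ β mxx mxpi mpipi : ℝ)
    (hσ : 0 < σ) (hlam : 0 < lam) (hψ : 0 < ψ) (hμ : 0 < μ) (hβ : 0 < β)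
    (hmxx : 0 < mxx) (hmxpi : 0 < mxpi) (hmpipi : 0 < mpipi)
    (hA1 : ψ < mxpi / (β * mpipi))
    (p d : ℝ) (hp0 : 0 < p) (hp1 : p ≤ 1) (hd : 0 < d) :
    ∀ ℓ : ℕ, 1 ≤ ℓ → ∀ j : Fin 2,
      ((∑ i ∈ Finset.range ℓ, (p • NKmatA σ lam ψ β mxx mxpi mpipi) ^ i).mulVec
          (d • NKvecC σ lam ψ)) j < 0 ∧
      ((∑ i ∈ Finset.range (ℓ + 1), (p • NKmatA σ lam ψ β mxx mxpi mpipi) ^ i).mulVec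
          (d • NKvecC σ lam ψ)) j <
        ((∑ i ∈ Finset.range ℓ, (p • NKmatA σ lam ψ β mxx mxpi mpipi) ^ i).mulVec
          (d • NKvecC σ lam ψ)) j := by
  intro ℓ hℓ j
  have hterm : ∀ k, (((p • NKmatA σ lam ψ β mxx mxpi mpipi) ^ k).mulVec
      (d • NKvecC σ lam ψ)) j < 0 := fun k =>
    Matrix.pow_mulVec_neg_of_pos
      (fun i j => mul_pos hp0 (NKmatA_pos hσ hlam hψ hβ hmxx hmxpi hmpipi hA1 i j))
      (fun i => mul_neg_of_pos_of_neg hd (NKvecC_neg hσ hlam hψ i)) k j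
  constructor
  · rw [Matrix.sum_mulVec, Finset.sum_apply]
    exact Finset.sum_neg (fun k _ => hterm k) ⟨0, Finset.mem_range.mpr hℓ⟩
  · rw [Finset.sum_range_succ, Matrix.add_mulVec, Pi.add_apply]
    exact add_lt_of_neg_right _ (hterm ℓ)
end

section
/- Let σ, λ, ψ, μ, β, m_xx, m_xπ, m_ππ be strictly positive reals and set A* := [[m_xx, σ·m_xπ], [λ·m_xx, λσ·m_xπ + β·m_ππ]] and F(p) := (1 − p·m_xx)(1 − p·β·m_ππ) − p·λσ·m_xπ. Then: (a) A* has two distinct real eigenvalues 0 < λ₂ < λ₁, and det A* = m_xx·β·m_ππ; (b) for every real p, det(I − p·A*) = F(p); (c) setting p̄ := 1/λ₁, for every p > 0 the spectral radius of p·A* is strictly less than 1 if and only if p < p̄, and p̄ is the smaller positive root of the quadratic F; moreover F(0) = 1 and F is convex in p. -/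
/-- The ELB-regime transition matrix `A*` of the New Keynesian model. -/
noncomputable def NKmatAstar (σ lam β mxx mxpi mpipi : ℝ) : Matrix (Fin 2) (Fin 2) ℝ :=
  !![mxx, σ * mxpi; lam * mxx, lam * σ * mxpi + β * mpipi]

/-- The stability quadratic `F(p) = (1 − p m_xx)(1 − p β m_ππ) − p λσ m_xπ`. -/
noncomputable def NKF (σ lam β mxx mxpi mpipi : ℝ) (p : ℝ) : ℝ :=
  (1 - p * mxx) * (1 - p * β * mpipi) - p * lam * σ * mxpi

/-- If `T`, `D` and `T ^ 2 - 4 * D` are positive, some two distinct positive reals have sum `T`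
and product `D`. -/
lemma exists_pos_lt_of_sum_prod {T D : ℝ} (hT : 0 < T) (hD : 0 < D) (hdisc : 0 < T ^ 2 - 4 * D) :
    ∃ l1 l2 : ℝ, 0 < l2 ∧ l2 < l1 ∧ l1 + l2 = T ∧ l1 * l2 = D := by
  have hs : 0 < √(T ^ 2 - 4 * D) := Real.sqrt_pos.mpr hdisc
  have hsq : √(T ^ 2 - 4 * D) ^ 2 = T ^ 2 - 4 * D := Real.sq_sqrt hdisc.le
  have hlt : √(T ^ 2 - 4 * D) < T := by nlinarith
  exact ⟨(T + √(T ^ 2 - 4 * D)) / 2, (T - √(T ^ 2 - 4 * D)) / 2,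
    by linarith, by linarith, by ring, by linarith⟩

lemma NKF_eq_factored {σ lam β mxx mxpi mpipi l1 l2 : ℝ}
    (hsum : l1 + l2 = mxx + lam * σ * mxpi + β * mpipi) (hprod : l1 * l2 = mxx * β * mpipi)
    (p : ℝ) : NKF σ lam β mxx mxpi mpipi p = (1 - p * l1) * (1 - p * l2) := by
  unfold NKF
  linear_combination p * hsum - p ^ 2 * hprod

lemma NKmatAstar_charpoly_eq_factored {σ lam β mxx mxpi mpipi l1 l2 : ℝ}
    (hsum : l1 + l2 = mxx + lam * σ * mxpi + β * mpipi) (hprod : l1 * l2 = mxx * β * mpipi) :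
    (NKmatAstar σ lam β mxx mxpi mpipi).charpoly =
      (Polynomial.X - Polynomial.C l1) * (Polynomial.X - Polynomial.C l2) := by
  have htr : (NKmatAstar σ lam β mxx mxpi mpipi).trace = l1 + l2 := by
    rw [NKmatAstar, Matrix.trace_fin_two_of]
    linarith
  have hdet : (NKmatAstar σ lam β mxx mxpi mpipi).det = l1 * l2 := by
    rw [NKmatAstar, Matrix.det_fin_two_of]
    linarith
  rw [Matrix.charpoly_fin_two, htr, hdet, Polynomial.C_add, Polynomial.C_mul]
  ring

lemma isRoot_charpoly_smul_NKmatAstar_iff {σ lam β mxx mxpi mpipi l1 l2 : ℝ}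
    (hsum : l1 + l2 = mxx + lam * σ * mxpi + β * mpipi) (hprod : l1 * l2 = mxx * β * mpipi)
    (p : ℝ) (z : ℂ) :
    ((p • NKmatAstar σ lam β mxx mxpi mpipi).map Complex.ofReal).charpoly.IsRoot z ↔
      z = ((p * l1 : ℝ) : ℂ) ∨ z = ((p * l2 : ℝ) : ℂ) := by
  have hsum' : (l1 : ℂ) + l2 = mxx + lam * σ * mxpi + β * mpipi := by exact_mod_cast hsum
  have hprod' : (l1 : ℂ) * l2 = mxx * β * mpipi := by exact_mod_cast hprod
  have heval : ((p • NKmatAstar σ lam β mxx mxpi mpipi).map Complex.ofReal).charpoly.eval z =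
      (z - ((p * l1 : ℝ) : ℂ)) * (z - ((p * l2 : ℝ) : ℂ)) := by
    simp only [Matrix.charpoly_fin_two, Matrix.trace_fin_two, Matrix.det_fin_two, NKmatAstar,
      Matrix.map_apply, Matrix.smul_apply, Matrix.of_apply, Matrix.cons_val', Matrix.cons_val_zero,
      Matrix.cons_val_one, Matrix.cons_val_fin_one, smul_eq_mul, Polynomial.eval_add,
      Polynomial.eval_sub, Polynomial.eval_mul, Polynomial.eval_pow, Polynomial.eval_X,
      Polynomial.eval_C]
    push_cast
    linear_combination z * p * hsum' - p ^ 2 * hprod'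
  rw [Polynomial.IsRoot.def, heval, mul_eq_zero, sub_eq_zero, sub_eq_zero]

lemma convexOn_NKF {σ lam β mxx mxpi mpipi : ℝ} (h : 0 ≤ mxx * β * mpipi) :
    ConvexOn ℝ Set.univ (NKF σ lam β mxx mxpi mpipi) := by
  refine ⟨convex_univ, fun x _ y _ a b ha hb hab => ?_⟩
  obtain rfl : b = 1 - a := by linarith
  simp only [NKF, smul_eq_mul]
  have hgap : 0 ≤ mxx * β * mpipi * (a * (1 - a) * (x - y) ^ 2) := by positivity
  linarith

/-- (a) `A*` has two distinct real eigenvalues `0 < λ₂ < λ₁` and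
`det A* = m_xx β m_ππ`; (b) `det(I − p A*) = F(p)` for every `p`; (c) with
`p̄ := 1/λ₁`, for `p > 0` the spectral radius of `p A*` is `< 1` iff `p < p̄`, and
`p̄` is the smaller positive root of `F`; moreover `F(0) = 1` and `F` is convex. -/
theorem Astar_eigenvalues_and_stability_threshold
    (σ lam ψ μ β mxx mxpi mpipi : ℝ)
    (hσ : 0 < σ) (hlam : 0 < lam) (hψ : 0 < ψ) (hμ : 0 < μ) (hβ : 0 < β)
    (hmxx : 0 < mxx) (hmxpi : 0 < mxpi) (hmpipi : 0 < mpipi) :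
    ∃ l1 l2 : ℝ, 0 < l2 ∧ l2 < l1 ∧
      (NKmatAstar σ lam β mxx mxpi mpipi).charpoly =
        (Polynomial.X - Polynomial.C l1) * (Polynomial.X - Polynomial.C l2) ∧
      (NKmatAstar σ lam β mxx mxpi mpipi).det = mxx * β * mpipi ∧
      (∀ p : ℝ,
        ((1 : Matrix (Fin 2) (Fin 2) ℝ) - p • NKmatAstar σ lam β mxx mxpi mpipi).det =
          NKF σ lam β mxx mxpi mpipi p) ∧
      (∀ p : ℝ, 0 < p →
        ((∀ z : ℂ,
            ((p • NKmatAstar σ lam β mxx mxpi mpipi).map Complex.ofReal).charpoly.IsRoot z →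
              ‖z‖ < 1) ↔ p < 1 / l1)) ∧
      NKF σ lam β mxx mxpi mpipi (1 / l1) = 0 ∧
      (∀ q : ℝ, 0 < q → NKF σ lam β mxx mxpi mpipi q = 0 → 1 / l1 ≤ q) ∧
      NKF σ lam β mxx mxpi mpipi 0 = 1 ∧
      ConvexOn ℝ Set.univ (NKF σ lam β mxx mxpi mpipi) := by
  have hprod : 0 < mxx * β * mpipi := by positivity
  obtain ⟨l1, l2, h2, h21, hsum, hdet⟩ := exists_pos_lt_of_sum_prod
    (T := mxx + lam * σ * mxpi + β * mpipi) (D := mxx * β * mpipi) (by positivity) hprod (by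
      have hcross : 0 < lam * σ * mxpi * (lam * σ * mxpi + 2 * mxx + 2 * (β * mpipi)) := by
        positivity
      linarith [sq_nonneg (mxx - β * mpipi)])
  have h1 : 0 < l1 := h2.trans h21
  refine ⟨l1, l2, h2, h21, NKmatAstar_charpoly_eq_factored hsum hdet, ?_, fun p => ?_,
    fun p hp => ?_, ?_, fun q hq hroot => ?_, ?_, convexOn_NKF hprod.le⟩
  · rw [NKmatAstar, Matrix.det_fin_two_of]
    ring
  · simp [NKmatAstar, NKF, Matrix.det_fin_two]
    ring
  · simp only [isRoot_charpoly_smul_NKmatAstar_iff hsum hdet, forall_eq_or_imp, forall_eq,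
      Complex.norm_real, Real.norm_of_nonneg (mul_pos hp h1).le,
      Real.norm_of_nonneg (mul_pos hp h2).le]
    rw [lt_div_iff₀ h1]
    exact ⟨fun h => h.1, fun h => ⟨h, (mul_lt_mul_of_pos_left h21 hp).trans h⟩⟩
  · rw [NKF_eq_factored hsum hdet, one_div_mul_cancel h1.ne', sub_self, zero_mul]
  · rw [NKF_eq_factored hsum hdet, mul_eq_zero] at hroot
    rw [div_le_iff₀ h1]
    have hlt := mul_lt_mul_of_pos_left h21 hq
    rcases hroot with h | h <;> linarith
  · simp [NKF]
end

section
/- Let σ, λ, ψ, μ, β, m_xx, m_xπ, m_ππ be strictly positive reals, let p ∈ (0,1], and suppose the demand shock satisfies d > σμ and F(p) := (1 − p·m_xx)(1 − p·β·m_ππ) − p·λσ·m_xπ ≤ 0. Set A* := [[m_xx, σ·m_xπ], [λ·m_xx, λσ·m_xπ + β·m_ππ]] and let v := (−d + σμ)·(1, λ)ᵀ (which is entrywise strictly negative). Then each component of the partial sums X*(ℓ) := (Σ_{i=0}^{ℓ−1} (p·A*)^i)·v tends to −∞ as ℓ → ∞. -/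
open Filter in
/-- If a nonnegative matrix `B` has a strictly positive subinvariant vector `u ≤ B u` lying below
`v`, then every component of the Neumann partial sums applied to `v` diverges to `+∞`. -/
theorem tendsto_sum_pow_mulVec_atTop {n : Type*} [Fintype n] [DecidableEq n]
    {B : Matrix n n ℝ} (hB : ∀ i j, 0 ≤ B i j) {u v : n → ℝ} (hu : ∀ j, 0 < u j)
    (huv : u ≤ v) (huB : u ≤ B.mulVec u) (j : n) :
    Tendsto (fun ℓ : ℕ => ((∑ i ∈ Finset.range ℓ, B ^ i).mulVec v) j) atTop atTop := by
  have hpow : ∀ i : ℕ, u ≤ (B ^ i).mulVec v := by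
    intro i
    induction i with
    | zero => simpa using huv
    | succ i ih =>
      rw [pow_succ', ← Matrix.mulVec_mulVec]
      exact huB.trans fun k => Finset.sum_le_sum fun l _ =>
        mul_le_mul_of_nonneg_left (ih l) (hB k l)
  refine tendsto_atTop_mono (f := fun ℓ : ℕ => (ℓ : ℝ) * u j) (fun ℓ => ?_)
    (tendsto_natCast_atTop_atTop.atTop_mul_const (hu j))
  rw [Matrix.sum_mulVec, Finset.sum_apply, ← nsmul_eq_mul]
  simpa using Finset.card_nsmul_le_sum (Finset.range ℓ) (fun i => ((B ^ i).mulVec v) j) (u j)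
    fun i _ => hpow i j

/-- A positive `2 × 2` matrix `B` with `det (1 - B) ≤ 0` has a strictly positive subinvariant
vector. -/
theorem exists_pos_le_mulVec {B : Matrix (Fin 2) (Fin 2) ℝ} (hB : ∀ i j, 0 < B i j)
    (hdet : (1 - B).det ≤ 0) : ∃ u : Fin 2 → ℝ, (∀ j, 0 < u j) ∧ u ≤ B.mulVec u := by
  have h01 := hB 0 1
  have h10 := hB 1 0
  have h11 := hB 1 1
  simp only [Matrix.det_fin_two, Matrix.sub_apply, Matrix.one_fin_two, Matrix.of_apply,
    Matrix.cons_val', Matrix.cons_val_zero, Matrix.cons_val_one, Matrix.cons_val_fin_one] at hdet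
  rcases le_or_gt 1 (B 0 0) with h | h
  · refine ⟨![1, B 1 0], by simp [Fin.forall_fin_two, h10], ?_⟩
    simp only [Pi.le_def, Fin.forall_fin_two, Matrix.mulVec, dotProduct, Fin.sum_univ_two,
      Matrix.cons_val_zero, Matrix.cons_val_one]
    constructor <;> nlinarith [mul_pos h01 h10, mul_pos h11 h10]
  · refine ⟨![B 0 1, 1 - B 0 0], by simp [Fin.forall_fin_two, h01, h], ?_⟩
    simp only [Pi.le_def, Fin.forall_fin_two, Matrix.mulVec, dotProduct, Fin.sum_univ_two,
      Matrix.cons_val_zero, Matrix.cons_val_one]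
    constructor <;> nlinarith

/-- A strictly positive vector can be scaled to lie below another strictly positive vector. -/
theorem exists_pos_smul_le {n : Type*} [Finite n] {u v : n → ℝ} (hu : ∀ j, 0 < u j)
    (hv : ∀ j, 0 < v j) : ∃ c : ℝ, 0 < c ∧ c • u ≤ v := by
  cases isEmpty_or_nonempty n
  · exact ⟨1, one_pos, isEmptyElim⟩
  · obtain ⟨k, hk⟩ := Finite.exists_min fun j => v j / u j
    exact ⟨v k / u k, div_pos (hv k) (hu k), fun j => (le_div_iff₀ (hu j)).1 (hk j)⟩

/-- If `d > σμ` and `F(p) ≤ 0` (unstable ELB dynamics, `p ≥ p̄`),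
then the forcing vector `v = (−d+σμ)·(1,λ)ᵀ` is entrywise strictly negative and each
component of the partial sums `X*(ℓ) = (Σ_{i<ℓ}(pA*)^i)·v` tends to `−∞`. -/
theorem pure_elb_divergence
    (σ lam ψ μ β mxx mxpi mpipi : ℝ)
    (hσ : 0 < σ) (hlam : 0 < lam) (hψ : 0 < ψ) (hμ : 0 < μ) (hβ : 0 < β)
    (hmxx : 0 < mxx) (hmxpi : 0 < mxpi) (hmpipi : 0 < mpipi)
    (p : ℝ) (hp0 : 0 < p) (hp1 : p ≤ 1) (d : ℝ) (hd : σ * μ < d)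
    (hF : (1 - p * mxx) * (1 - p * β * mpipi) - p * lam * σ * mxpi ≤ 0) :
    (∀ j : Fin 2, ((-d + σ * μ) • (![1, lam] : Fin 2 → ℝ)) j < 0) ∧
    ∀ j : Fin 2,
      Filter.Tendsto
        (fun ℓ : ℕ =>
          ((∑ i ∈ Finset.range ℓ, (p • NKmatAstar σ lam β mxx mxpi mpipi) ^ i).mulVec
            ((-d + σ * μ) • (![1, lam] : Fin 2 → ℝ))) j)
        Filter.atTop Filter.atBot := by
  have hv : ∀ j : Fin 2, ((-d + σ * μ) • (![1, lam] : Fin 2 → ℝ)) j < 0 := by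
    have hneg : -d + σ * μ < 0 := by linarith
    simpa [Fin.forall_fin_two, hneg] using mul_neg_of_neg_of_pos hneg hlam
  refine ⟨hv, fun j => ?_⟩
  generalize (-d + σ * μ) • (![1, lam] : Fin 2 → ℝ) = v at hv ⊢
  have hB : ∀ i j, 0 < (p • NKmatAstar σ lam β mxx mxpi mpipi) i j := by
    simp only [Fin.forall_fin_two, NKmatAstar, Matrix.smul_apply, Matrix.of_apply,
      Matrix.cons_val', Matrix.cons_val_zero, Matrix.cons_val_one, Matrix.cons_val_fin_one,
      smul_eq_mul]
    refine ⟨⟨?_, ?_⟩, ?_, ?_⟩ <;> positivity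
  have hdet : (1 - p • NKmatAstar σ lam β mxx mxpi mpipi).det ≤ 0 := by
    refine le_of_eq_of_le ?_ hF
    simp [Matrix.det_fin_two, NKmatAstar]
    ring
  obtain ⟨u, hu, huB⟩ := exists_pos_le_mulVec hB hdet
  obtain ⟨c, hc, hcu⟩ := exists_pos_smul_le hu (v := -v) fun j => neg_pos.2 (hv j)
  have key := tendsto_sum_pow_mulVec_atTop (u := c • u) (fun i j => (hB i j).le)
    (fun j => mul_pos hc (hu j)) hcu
    (by rw [Matrix.mulVec_smul]; exact smul_le_smul_of_nonneg_left huB hc.le) j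
  simpa only [Matrix.mulVec_neg, Pi.neg_apply, Filter.tendsto_neg_atTop_iff] using key
end

section
/- Let M be a 2×2 real matrix with det(I − M) ≠ 0, let v ∈ ℝ², and define the scalar sequence s(ℓ) := e₁ᵀ·(Σ_{i=0}^{ℓ−1} M^i)·v for ℓ ≥ 1, where e₁ = (1,0)ᵀ. Let τ := tr(M), δ := det(M), and α := e₁ᵀ·(I − M)^{−1}·v. Then for every ℓ ≥ 1: s(ℓ+2) = τ·s(ℓ+1) − δ·s(ℓ) + (1 − τ + δ)·α. -/
namespace Matrix

variable {R : Type*} [CommRing R]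

/-- Cayley–Hamilton for `2 × 2` matrices. -/
theorem sq_eq_trace_smul_sub_det_smul_one (M : Matrix (Fin 2) (Fin 2) R) :
    M ^ 2 = M.trace • M - M.det • (1 : Matrix (Fin 2) (Fin 2) R) := by
  ext i j
  fin_cases i <;> fin_cases j <;>
    simp [pow_two, mul_apply, trace_fin_two, det_fin_two] <;> ring

theorem adjugate_one_sub_fin_two (M : Matrix (Fin 2) (Fin 2) R) :
    (1 - M).adjugate = 1 + M - M.trace • (1 : Matrix (Fin 2) (Fin 2) R) := by
  ext i j
  fin_cases i <;> fin_cases j <;> simp [adjugate_fin_two, trace_fin_two]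
  all_goals ring

theorem det_one_sub_fin_two (M : Matrix (Fin 2) (Fin 2) R) :
    (1 - M).det = 1 - M.trace + M.det := by
  simp [det_fin_two, trace_fin_two]
  ring

/-- Partial geometric sums of a `2 × 2` matrix satisfy a second-order linear recursion. -/
theorem sum_range_pow_add_two_fin_two (M : Matrix (Fin 2) (Fin 2) R) (n : ℕ) :
    ∑ i ∈ Finset.range (n + 2), M ^ i =
      M.trace • ∑ i ∈ Finset.range (n + 1), M ^ i
        - M.det • ∑ i ∈ Finset.range n, M ^ i + (1 - M).adjugate := by
  induction n with
  | zero =>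
    simp [Finset.sum_range_succ, adjugate_one_sub_fin_two]
  | succ n ih =>
    have hpow : M ^ (n + 2) = M.trace • M ^ (n + 1) - M.det • M ^ n := by
      rw [pow_add, sq_eq_trace_smul_sub_det_smul_one, mul_sub, mul_smul_comm, mul_smul_comm,
        mul_one, pow_succ]
    calc ∑ i ∈ Finset.range (n + 1 + 2), M ^ i
        = M.trace • ∑ i ∈ Finset.range (n + 1), M ^ i
          - M.det • ∑ i ∈ Finset.range n, M ^ i + (1 - M).adjugate
          + (M.trace • M ^ (n + 1) - M.det • M ^ n) := by
          rw [Finset.sum_range_succ _ (n + 2), ih, hpow]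
      _ = _ := by
          rw [Finset.sum_range_succ _ (n + 1), Finset.sum_range_succ _ n]
          module

end Matrix

/-- AR(2) representation of partial geometric sums. For a 2×2 real
matrix `M` with `det(I − M) ≠ 0`, the scalar sequence
`s(ℓ) = e₁ᵀ·(Σ_{i<ℓ} M^i)·v` satisfies, with `τ = tr M`, `δ = det M` and
`α = e₁ᵀ(I − M)⁻¹v`, the recursion `s(ℓ+2) = τ s(ℓ+1) − δ s(ℓ) + (1 − τ + δ)α`. -/
theorem multiplier_ar2_recursion
    (M : Matrix (Fin 2) (Fin 2) ℝ)
    (hM : ((1 : Matrix (Fin 2) (Fin 2) ℝ) - M).det ≠ 0)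
    (v : Fin 2 → ℝ) :
    ∀ ℓ : ℕ, 1 ≤ ℓ →
      ((∑ i ∈ Finset.range (ℓ + 2), M ^ i).mulVec v) 0 =
        M.trace * ((∑ i ∈ Finset.range (ℓ + 1), M ^ i).mulVec v) 0
          - M.det * ((∑ i ∈ Finset.range ℓ, M ^ i).mulVec v) 0
          + (1 - M.trace + M.det) * (((1 - M)⁻¹).mulVec v) 0 := by
  intro ℓ _
  have hadj : (1 - M).adjugate = (1 - M.trace + M.det) • (1 - M)⁻¹ := by
    rw [← Matrix.det_one_sub_fin_two, Matrix.inv_def, smul_smul,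
      Ring.mul_inverse_cancel _ hM.isUnit, one_smul]
  rw [Matrix.sum_range_pow_add_two_fin_two, hadj]
  simp only [Matrix.add_mulVec, Matrix.sub_mulVec, Matrix.smul_mulVec, Pi.add_apply,
    Pi.sub_apply, Pi.smul_apply, smul_eq_mul]
end

section
/- Let σ, λ, β, m_xx, m_xπ, m_ππ be strictly positive reals, let p ∈ (0,1], and set A* := [[m_xx, σ·m_xπ], [λ·m_xx, λσ·m_xπ + β·m_ππ]]. For n ≥ 0 let H(n) := Σ_{i=0}^{n} (p·A*)^i and let H₁₂(n) denote its (1,2) entry. Then H₁₂(0) = 0, the sequence (H₁₂(n))_{n≥0} is strictly increasing, and H₁₂(n) > 0 for all n ≥ 1. Consequently, for any constant g > 0, the ELB consumption multiplier m(ℓ) := g·H₁₂(ℓ−1) satisfies m(1) = 0, m(ℓ) > 0 for all ℓ ≥ 2, and m is strictly increasing in ℓ. -/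
/-- `H₁₂(n)`: the (1,2) entry of `Σ_{i=0}^{n} (p·A*)^i`. -/
noncomputable def NKH12 (σ lam β mxx mxpi mpipi p : ℝ) (n : ℕ) : ℝ :=
  (∑ i ∈ Finset.range (n + 1), (p • NKmatAstar σ lam β mxx mxpi mpipi) ^ i) 0 1

/-- Positive powers of an entrywise positive matrix are entrywise positive. -/
theorem Matrix.pow_succ_apply_pos {ι R : Type*} [Fintype ι] [DecidableEq ι] [Semiring R]
    [PartialOrder R] [IsStrictOrderedRing R] {A : Matrix ι ι R} (hA : ∀ i j, 0 < A i j)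
    (n : ℕ) (i j : ι) : 0 < (A ^ (n + 1)) i j := by
  induction n generalizing i j with
  | zero => simpa using hA i j
  | succ n ih =>
    rw [pow_succ, Matrix.mul_apply]
    exact Finset.sum_pos (fun k _ => mul_pos (ih i k) (hA k j)) ⟨i, Finset.mem_univ i⟩

/-- `H₁₂(0) = 0`, the sequence `H₁₂(n)` is strictly increasing and
strictly positive for `n ≥ 1`; consequently the ELB consumption multiplier
`m(ℓ) = g·H₁₂(ℓ−1)` satisfies `m(1) = 0`, `m(ℓ) > 0` for all `ℓ ≥ 2`, and is
strictly increasing in `ℓ`. -/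
theorem elb_multiplier_positive_increasing
    (σ lam β mxx mxpi mpipi : ℝ)
    (hσ : 0 < σ) (hlam : 0 < lam) (hβ : 0 < β)
    (hmxx : 0 < mxx) (hmxpi : 0 < mxpi) (hmpipi : 0 < mpipi)
    (p : ℝ) (hp0 : 0 < p) (hp1 : p ≤ 1) :
    NKH12 σ lam β mxx mxpi mpipi p 0 = 0 ∧
    StrictMono (fun n : ℕ => NKH12 σ lam β mxx mxpi mpipi p n) ∧
    (∀ n : ℕ, 1 ≤ n → 0 < NKH12 σ lam β mxx mxpi mpipi p n) ∧
    ∀ g : ℝ, 0 < g →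
      g * NKH12 σ lam β mxx mxpi mpipi p (1 - 1) = 0 ∧
      (∀ ℓ : ℕ, 2 ≤ ℓ → 0 < g * NKH12 σ lam β mxx mxpi mpipi p (ℓ - 1)) ∧
      (∀ ℓ : ℕ, 1 ≤ ℓ →
        g * NKH12 σ lam β mxx mxpi mpipi p (ℓ - 1) <
          g * NKH12 σ lam β mxx mxpi mpipi p (ℓ + 1 - 1)) := by
  have hA : ∀ i j, 0 < (p • NKmatAstar σ lam β mxx mxpi mpipi) i j := by
    intro i j
    fin_cases i <;> fin_cases j <;> simp [NKmatAstar] <;> positivity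
  have zero : NKH12 σ lam β mxx mxpi mpipi p 0 = 0 := by simp [NKH12]
  have mono : StrictMono (fun n : ℕ => NKH12 σ lam β mxx mxpi mpipi p n) := by
    refine strictMono_nat_of_lt_succ fun n => ?_
    simp only [NKH12]
    rw [Finset.sum_range_succ _ (n + 1), Matrix.add_apply]
    exact lt_add_of_pos_right _ (Matrix.pow_succ_apply_pos hA n 0 1)
  have pos : ∀ n : ℕ, 1 ≤ n → 0 < NKH12 σ lam β mxx mxpi mpipi p n :=
    fun n hn => zero ▸ mono (Nat.lt_of_lt_of_le Nat.zero_lt_one hn)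
  refine ⟨zero, mono, pos, fun g hg => ⟨by simp [zero], fun ℓ hℓ => ?_, fun ℓ hℓ => ?_⟩⟩
  · exact mul_pos hg (pos _ (by omega))
  · exact mul_lt_mul_of_pos_left (mono (by omega)) hg
end

section
/- Let σ, λ, β, m_xx, m_xπ, m_ππ be strictly positive reals, let p ∈ (0,1], set A* := [[m_xx, σ·m_xπ], [λ·m_xx, λσ·m_xπ + β·m_ππ]], F(p) := (1 − p·m_xx)(1 − p·β·m_ππ) − p·λσ·m_xπ, and for g > 0 define the ELB consumption multiplier m(ℓ) := g·H₁₂(ℓ−1), where H₁₂(n) is the (1,2) entry of Σ_{i=0}^{n}(p·A*)^i. Then: (a) if F(p) > 0 and the spectral radius of p·A* is strictly less than 1, then m(ℓ) converges as ℓ → ∞ to the strictly positive finite value g·p·σ·m_xπ / F(p); (b) if the spectral radius of p·A* is at least 1, then m(ℓ) → +∞ as ℓ → ∞. -/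
open Filter

/-- Closed form of the powers of a `2 × 2` matrix with eigenvalues `r` and `s`. -/
theorem Matrix.sub_smul_pow_fin_two (M : Matrix (Fin 2) (Fin 2) ℝ) {r s : ℝ}
    (htr : r + s = M.trace) (hdet : r * s = M.det) (i : ℕ) :
    (r - s) • M ^ i = r ^ i • (M - s • 1) - s ^ i • (M - r • 1) := by
  have hsq : M * M = (r + s) • M - (r * s) • 1 := by
    rw [htr, hdet, Matrix.trace_fin_two, Matrix.det_fin_two]
    ext j k
    fin_cases j <;> fin_cases k <;> simp [Matrix.mul_apply, Fin.sum_univ_two] <;> ring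
  induction i with
  | zero => simp only [pow_zero]; module
  | succ i ih =>
    rw [pow_succ, ← smul_mul_assoc, ih]
    simp only [sub_mul, smul_mul_assoc, one_mul, hsq, pow_succ]
    module

theorem Matrix.sub_mul_pow_apply_zero_one (M : Matrix (Fin 2) (Fin 2) ℝ) {r s : ℝ}
    (htr : r + s = M.trace) (hdet : r * s = M.det) (i : ℕ) :
    (r - s) * (M ^ i) 0 1 = M 0 1 * (r ^ i - s ^ i) := by
  have h := congrFun (congrFun (M.sub_smul_pow_fin_two htr hdet i) 0) 1
  simp at h
  linarith

/-- A real `2 × 2` matrix with positive entries and positive determinant has two distinct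
positive eigenvalues. -/
theorem Matrix.exists_eigenvalues_fin_two (M : Matrix (Fin 2) (Fin 2) ℝ)
    (hpos : ∀ i j, 0 < M i j) (hdet : 0 < M.det) :
    ∃ r s : ℝ, 0 < s ∧ s < r ∧ r + s = M.trace ∧ r * s = M.det := by
  have htr : 0 < M.trace := by
    rw [Matrix.trace_fin_two]; exact add_pos (hpos 0 0) (hpos 1 1)
  have hD : 0 < M.trace ^ 2 - 4 * M.det := by
    rw [Matrix.trace_fin_two, Matrix.det_fin_two]
    nlinarith [mul_pos (hpos 0 1) (hpos 1 0), sq_nonneg (M 0 0 - M 1 1)]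
  have hq := Real.sqrt_pos.2 hD
  have hqq := Real.sq_sqrt hD.le
  set q := √(M.trace ^ 2 - 4 * M.det)
  refine ⟨(M.trace + q) / 2, (M.trace - q) / 2, ?_, by linarith, by ring, by linarith⟩
  have : q < M.trace := lt_of_pow_lt_pow_left₀ 2 htr.le (by linarith)
  linarith

theorem Matrix.isRoot_charpoly_map_ofReal_iff (M : Matrix (Fin 2) (Fin 2) ℝ) {r s : ℝ}
    (htr : r + s = M.trace) (hdet : r * s = M.det) (z : ℂ) :
    (M.map Complex.ofReal).charpoly.IsRoot z ↔ z = r ∨ z = s := by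
  have htr' : (M.map Complex.ofReal).trace = (r : ℂ) + s := by
    rw [← Complex.ofReal_add, htr]; simp [Matrix.trace_fin_two]
  have hdet' : (M.map Complex.ofReal).det = (r : ℂ) * s := by
    rw [← Complex.ofReal_mul, hdet]; simp [Matrix.det_fin_two]
  rw [Matrix.charpoly_fin_two, htr', hdet', ← sub_eq_zero (a := z) (b := (r : ℂ)),
    ← sub_eq_zero (a := z) (b := (s : ℂ)), ← mul_eq_zero]
  simp only [Polynomial.IsRoot.def, Polynomial.eval_add, Polynomial.eval_sub, Polynomial.eval_mul,
    Polynomial.eval_pow, Polynomial.eval_X, Polynomial.eval_C]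
  ring_nf

/-- The off-diagonal Neumann series of a matrix whose eigenvalues lie in `(0, 1)`. -/
theorem Matrix.hasSum_pow_apply_zero_one (M : Matrix (Fin 2) (Fin 2) ℝ) {r s : ℝ}
    (htr : r + s = M.trace) (hdet : r * s = M.det) (hs : 0 < s) (hsr : s < r) (hr : r < 1) :
    HasSum (fun i => (M ^ i) 0 1) (M 0 1 / ((1 - r) * (1 - s))) := by
  have hrs : r - s ≠ 0 := by linarith
  have hr' : 1 - r ≠ 0 := by linarith
  have hs' : 1 - s ≠ 0 := by linarith
  have hsum := ((hasSum_geometric_of_lt_one (hs.trans hsr).le hr).sub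
    (hasSum_geometric_of_lt_one hs.le (hsr.trans hr))).mul_left (M 0 1 / (r - s))
  have hterm (i : ℕ) : M 0 1 / (r - s) * (r ^ i - s ^ i) = (M ^ i) 0 1 := by
    rw [div_mul_eq_mul_div, ← M.sub_mul_pow_apply_zero_one htr hdet i, mul_div_cancel_left₀ _ hrs]
  have hval : M 0 1 / (r - s) * ((1 - r)⁻¹ - (1 - s)⁻¹) = M 0 1 / ((1 - r) * (1 - s)) := by
    field_simp
    ring
  simpa only [hterm, hval] using hsum

theorem Matrix.le_pow_succ_apply_zero_one (M : Matrix (Fin 2) (Fin 2) ℝ) {r s : ℝ}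
    (htr : r + s = M.trace) (hdet : r * s = M.det) (hs : 0 < s) (hsr : s < r) (hr : 1 ≤ r)
    (hM : 0 ≤ M 0 1) (i : ℕ) : M 0 1 ≤ (M ^ (i + 1)) 0 1 := by
  have hgrow : r - s ≤ r ^ (i + 1) - s ^ (i + 1) := by
    induction i with
    | zero => simp
    | succ i ih =>
      have hstep : r ^ (i + 1 + 1) - s ^ (i + 1 + 1)
          = r * (r ^ (i + 1) - s ^ (i + 1)) + s ^ (i + 1) * (r - s) := by ring
      nlinarith [mul_pos (pow_pos hs (i + 1)) (sub_pos.2 hsr)]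
  refine le_of_mul_le_mul_left ?_ (sub_pos.2 hsr)
  rw [M.sub_mul_pow_apply_zero_one htr hdet, mul_comm]
  exact mul_le_mul_of_nonneg_left hgrow hM

theorem Matrix.tendsto_sum_pow_apply_zero_one_atTop (M : Matrix (Fin 2) (Fin 2) ℝ) {r s : ℝ}
    (htr : r + s = M.trace) (hdet : r * s = M.det) (hs : 0 < s) (hsr : s < r) (hr : 1 ≤ r)
    (hM : 0 < M 0 1) :
    Tendsto (fun n => ∑ i ∈ Finset.range (n + 1), (M ^ i) 0 1) atTop atTop := by
  refine tendsto_atTop_mono (fun n => ?_) (tendsto_natCast_atTop_atTop.atTop_mul_const hM)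
  rw [Finset.sum_range_succ']
  have h := Finset.card_nsmul_le_sum (Finset.range n) (fun i => (M ^ (i + 1)) 0 1) (M 0 1)
    fun i _ => M.le_pow_succ_apply_zero_one htr hdet hs hsr hr hM.le i
  simpa using h


/-- Asymptotics of the ELB consumption multiplier `m(ℓ) = g·H₁₂(ℓ−1)`:
(a) if `F(p) > 0` and the spectral radius of `p·A*` is `< 1`, then `m(ℓ)` converges
to the strictly positive value `g·p·σ·m_xπ / F(p)`; (b) if the spectral radius of
`p·A*` is `≥ 1`, then `m(ℓ) → +∞`. -/
theorem elb_multiplier_asymptotics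
    (σ lam β mxx mxpi mpipi : ℝ)
    (hσ : 0 < σ) (hlam : 0 < lam) (hβ : 0 < β)
    (hmxx : 0 < mxx) (hmxpi : 0 < mxpi) (hmpipi : 0 < mpipi)
    (p : ℝ) (hp0 : 0 < p) (hp1 : p ≤ 1) (g : ℝ) (hg : 0 < g) :
    ((0 < (1 - p * mxx) * (1 - p * β * mpipi) - p * lam * σ * mxpi ∧
      (∀ z : ℂ,
        ((p • NKmatAstar σ lam β mxx mxpi mpipi).map Complex.ofReal).charpoly.IsRoot z →
          ‖z‖ < 1)) →
      (Filter.Tendsto (fun ℓ : ℕ => g * NKH12 σ lam β mxx mxpi mpipi p (ℓ - 1))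
          Filter.atTop
          (nhds (g * p * σ * mxpi /
            ((1 - p * mxx) * (1 - p * β * mpipi) - p * lam * σ * mxpi))) ∧
        0 < g * p * σ * mxpi /
          ((1 - p * mxx) * (1 - p * β * mpipi) - p * lam * σ * mxpi))) ∧
    ((∃ z : ℂ,
        ((p • NKmatAstar σ lam β mxx mxpi mpipi).map Complex.ofReal).charpoly.IsRoot z ∧
          1 ≤ ‖z‖) →
      Filter.Tendsto (fun ℓ : ℕ => g * NKH12 σ lam β mxx mxpi mpipi p (ℓ - 1))
        Filter.atTop Filter.atTop) := by
  set M := p • NKmatAstar σ lam β mxx mxpi mpipi with hMdef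
  set F := (1 - p * mxx) * (1 - p * β * mpipi) - p * lam * σ * mxpi with hF
  have h01 : M 0 1 = p * (σ * mxpi) := by simp [hMdef, NKmatAstar]
  have hpos : ∀ i j, 0 < M i j := by
    intro i j
    fin_cases i <;> fin_cases j <;> simp [hMdef, NKmatAstar] <;> positivity
  have hMdet : M.det = p ^ 2 * mxx * β * mpipi := by
    simp [hMdef, NKmatAstar, Matrix.det_fin_two]; ring
  have hMtr : M.trace = p * mxx + p * (lam * σ * mxpi + β * mpipi) := by
    simp [hMdef, NKmatAstar, Matrix.trace_fin_two]
  obtain ⟨r, s, hs, hsr, htr, hdet⟩ :=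
    M.exists_eigenvalues_fin_two hpos (by rw [hMdet]; positivity)
  have hroot := M.isRoot_charpoly_map_ofReal_iff htr hdet
  have hFrs : F = (1 - r) * (1 - s) := by
    have : (1 - r) * (1 - s) = 1 - (r + s) + r * s := by ring
    rw [this, htr, hdet, hMtr, hMdet, hF]; ring
  have hH : NKH12 σ lam β mxx mxpi mpipi p
      = fun n => ∑ i ∈ Finset.range (n + 1), (M ^ i) 0 1 := by
    ext n; simp only [NKH12, Matrix.sum_apply, hMdef]
  rw [hH]
  refine ⟨fun ⟨hFpos, hlt⟩ => ⟨?_, by positivity⟩, fun ⟨z, hz, hz1⟩ => ?_⟩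
  · have hr : r < 1 := by
      simpa [abs_of_pos (hs.trans hsr)] using hlt r ((hroot r).2 (Or.inl rfl))
    have hlim := (M.hasSum_pow_apply_zero_one htr hdet hs hsr hr).tendsto_sum_nat
    have hval : g * p * σ * mxpi / F = g * (M 0 1 / ((1 - r) * (1 - s))) := by
      rw [h01, hFrs]; ring
    rw [hval]
    exact (((tendsto_add_atTop_iff_nat 1).2 hlim).comp (tendsto_sub_atTop_nat 1)).const_mul g
  · have hr : 1 ≤ r := by
      rcases (hroot z).1 hz with rfl | rfl
      · simpa [abs_of_pos (hs.trans hsr)] using hz1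
      · rw [Complex.norm_real, Real.norm_of_nonneg hs.le] at hz1
        exact hz1.trans hsr.le
    exact ((M.tendsto_sum_pow_apply_zero_one_atTop htr hdet hs hsr hr (hpos 0 1)).comp
      (tendsto_sub_atTop_nat 1)).const_mul_atTop hg
end
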